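/- The set of all periodic semigroup varieties, the set of all overcommutative semigroup varieties, and the set of all commutative semigroup varieties are definable. -/

import Mathlib

open FirstOrder FreeSemigroup

/-! ### First-order definability in lattices

We formalize the first-order language of lattices (two binary function symbols,
interpreted as join and meet) and the notion of a subset of a lattice being
definable by a first-order formula with one free variable. -/

/-- The first-order language of lattices: two binary function symbols
(`0` = join, `1` = meet) and no relation symbols. -/
def latticeLang : Language :=
  ⟨fun n => match n with | 2 => Fin 2 | _ => Empty, fun _ => Empty⟩

/-- Any lattice is a structure for the language of lattices, interpreting the
function symbol `0` as join `⊔` and the symbol `1` as meet `⊓`. -/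
instance latticeStructure (L : Type*) [Lattice L] : latticeLang.Structure L where
  funMap := fun {n} f x =>
    match n, f with
    | 2, f => if (show Fin 2 from f) = 0 then x 0 ⊔ x 1 else x 0 ⊓ x 1
  RelMap := fun {n} r _ => r.elim

/-- A subset `A` of a lattice `L` is definable in `L` if there is a first-order
formula `φ` with one free variable in the language of the lattice operations
such that for all `a ∈ L`, `φ(a)` holds in `L` iff `a ∈ A`. -/
def IsDefinableIn (L : Type*) [Lattice L] (A : Set L) : Prop :=
  ∃ φ : latticeLang.Formula (Fin 1), ∀ a : L, φ.Realize (fun _ => a) ↔ a ∈ A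

/-! ### Semigroup identities and the lattice SEM of all semigroup varieties

A semigroup identity is a pair of words in the free semigroup on countably
many letters.  A semigroup variety is identified with its (semantically closed)
equational theory; the lattice of varieties is the dual of the lattice of
closed theories, ordered by inclusion. -/

/-- Words: elements of the free semigroup over the countable alphabet `ℕ`. -/
abbrev SgWord : Type := FreeSemigroup ℕ

/-- A semigroup identity `u = v` is a pair of words. -/
abbrev SgEq : Type := SgWord × SgWord

/-- A semigroup `S` satisfies the identity `e` if every valuation of the
letters in `S` gives the two words of `e` equal values. -/
def SatIdent (S : Type) [Semigroup S] (e : SgEq) : Prop :=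
  ∀ f : ℕ → S, FreeSemigroup.lift f e.1 = FreeSemigroup.lift f e.2

/-- The semantic closure of a set of identities: all identities holding in
every semigroup satisfying all identities of `E`. -/
def eqClosure (E : Set SgEq) : Set SgEq :=
  {e | ∀ (S : Type) (inst : Semigroup S),
        (∀ e' ∈ E, @SatIdent S inst e') → @SatIdent S inst e}

theorem subset_eqClosure (E : Set SgEq) : E ⊆ eqClosure E :=
  fun e he _S _inst h => h e he

theorem eqClosure_mono {E F : Set SgEq} (h : E ⊆ F) : eqClosure E ⊆ eqClosure F :=
  fun e he S inst hF => he S inst fun e' he' => hF e' (h he')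

theorem eqClosure_idem (E : Set SgEq) : eqClosure (eqClosure E) = eqClosure E := by
  refine Set.Subset.antisymm ?_ (subset_eqClosure _)
  intro e he S inst hE
  exact he S inst fun e' he' => he' S inst hE

/-- An equational theory of semigroups: a semantically closed set of identities. -/
abbrev SemigroupTheory : Type := {E : Set SgEq // eqClosure E = E}

/-- The closed theory generated by a set of identities. -/
def theoryClosure (E : Set SgEq) : SemigroupTheory := ⟨eqClosure E, eqClosure_idem E⟩

theorem theoryGC : GaloisConnection theoryClosure Subtype.val := by
  intro E T
  constructor
  · intro h
    exact (subset_eqClosure E).trans h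
  · intro h
    show eqClosure E ⊆ T.val
    rw [← T.2]
    exact eqClosure_mono h

def theoryGI : GaloisInsertion theoryClosure Subtype.val :=
  theoryGC.toGaloisInsertion fun T => subset_eqClosure T.val

instance : CompleteLattice SemigroupTheory := theoryGI.liftCompleteLattice

/-- The lattice **SEM** of all semigroup varieties: a variety is identified with
its equational theory, and the order (inclusion of varieties) is the dual of
inclusion of theories. -/
abbrev SemigroupVariety : Type := SemigroupTheoryᵒᵈ

/-- The set of identities holding in a variety. -/
def SemigroupVariety.ids (V : SemigroupVariety) : Set SgEq := (OrderDual.ofDual V).val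

/-- `var Σ`: the semigroup variety given by the identity system `Σ`. -/
def varOf (E : Set SgEq) : SemigroupVariety := OrderDual.toDual (theoryClosure E)

/-- Membership of a semigroup in a variety. -/
def MemVar (S : Type) [Semigroup S] (V : SemigroupVariety) : Prop :=
  ∀ e ∈ V.ids, SatIdent S e

/-- A set of semigroup varieties is definable if it is definable in the
lattice **SEM** of all semigroup varieties. -/
def IsDefinableVar (A : Set SemigroupVariety) : Prop :=
  IsDefinableIn SemigroupVariety A

/-! ### Words, powers, products of lists -/

/-- The letters `x`, `y`, `z`. -/
def wx : SgWord := of 0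
def wy : SgWord := of 1
def wz : SgWord := of 2

/-- `sPow a n = a ^ (n + 1)` in any magma. -/
def sPow {S : Type*} [Mul S] (a : S) : ℕ → S
  | 0 => a
  | n + 1 => sPow a n * a

/-- `sProd a l` is the product of the nonempty list `a :: l`. -/
def sProd {S : Type*} [Mul S] : S → List S → S
  | a, [] => a
  | a, b :: l => a * sProd b l

/-- The word given by a nonempty list of letters (junk value `x` on `[]`). -/
def wordOfList : List ℕ → SgWord
  | [] => of 0
  | x :: l => sProd (of x) (l.map of)

/-- The letter `x` occurs in the word `w`. -/
def occursIn (x : ℕ) (w : SgWord) : Prop := x = w.head ∨ x ∈ w.tail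

/-- The pair of identities `w x = w` and `x w = w` abbreviated by the symbolic
identity `w = 0` (here `x` is a letter, intended not to occur in `w`). -/
def zeroPairs (w : SgWord) (x : ℕ) : Set SgEq := {(w * of x, w), (of x * w, w)}

/-- A 0-reduced semigroup variety: one that may be given by identities of the
form `w = 0` only (a nonempty system of them). -/
def IsZeroReducedVariety (V : SemigroupVariety) : Prop :=
  ∃ I : Set (SgWord × ℕ), I.Nonempty ∧ (∀ p ∈ I, ¬ occursIn p.2 p.1) ∧
    V = varOf (⋃ p ∈ I, zeroPairs p.1 p.2)

/-- A commutative variety 0-reduced in **Com**: one that may be given by the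
commutative law together with a nonempty system of 0-reduced identities only. -/
def IsZeroReducedInCom (V : SemigroupVariety) : Prop :=
  ∃ I : Set (SgWord × ℕ), I.Nonempty ∧ (∀ p ∈ I, ¬ occursIn p.2 p.1) ∧
    V = varOf (insert (wx * wy, wy * wx) (⋃ p ∈ I, zeroPairs p.1 p.2))

/-! ### Particular varieties -/

/-- `COM = var{xy = yx}`, the variety of commutative semigroups. -/
def COMvar : SemigroupVariety := varOf {(wx * wy, wy * wx)}

/-- `SL = var{x² = x, xy = yx}`, the variety of semilattices. -/
def SLvar : SemigroupVariety := varOf {(wx * wx, wx), (wx * wy, wy * wx)}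

/-- `ZM = var{xy = 0}`, the variety of null semigroups. -/
def ZMvar : SemigroupVariety := varOf (zeroPairs (wx * wy) 2)

/-- `LZ = var{xy = x}`, the variety of left zero semigroups. -/
def LZvar : SemigroupVariety := varOf {(wx * wy, wx)}

/-- `RZ = var{xy = y}`, the variety of right zero semigroups. -/
def RZvar : SemigroupVariety := varOf {(wx * wy, wy)}

/-- `A_n = var{xⁿy = y, xy = yx}` (for `n ≥ 1`), the variety of Abelian groups
whose exponent divides `n`. -/
def Avar (n : ℕ) : SemigroupVariety :=
  varOf {(sPow wx (n - 1) * wy, wy), (wx * wy, wy * wx)}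

/-- `N_k = var{x² = x₁x₂⋯x_k = 0, xy = yx}` (for `k ≥ 1`). -/
def Nvar (k : ℕ) : SemigroupVariety :=
  varOf (zeroPairs (wx * wx) 1 ∪ zeroPairs (wordOfList (List.range k)) k ∪
    {(wx * wy, wy * wx)})

/-- `N_ω = var{x² = 0, xy = yx}`. -/
def Nomega : SemigroupVariety :=
  varOf (zeroPairs (wx * wx) 1 ∪ {(wx * wy, wy * wx)})

/-- `N₃² = var{x² = xyz = 0}`. -/
def N32var : SemigroupVariety :=
  varOf (zeroPairs (wx * wx) 1 ∪ zeroPairs (wx * wy * wz) 3)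

/-- `N₃^c = var{xyz = 0, xy = yx}`. -/
def N3cvar : SemigroupVariety :=
  varOf (zeroPairs (wx * wy * wz) 3 ∪ {(wx * wy, wy * wx)})

/-- `NILP_k = var{x₁x₂⋯x_k = 0}` (for `k ≥ 1`). -/
def NILPvar (k : ℕ) : SemigroupVariety :=
  varOf (zeroPairs (wordOfList (List.range k)) k)

/-- `P = var{xy = x²y, x²y² = y²x²}`. -/
def Pvar : SemigroupVariety :=
  varOf {(wx * wy, wx * wx * wy), (wx * wx * (wy * wy), wy * wy * (wx * wx))}

/-- `D_m = var{x^m = 0, xy = yx}` (for `m ≥ 1`). -/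
def Dvar (m : ℕ) : SemigroupVariety :=
  varOf (zeroPairs (sPow wx (m - 1)) 1 ∪ {(wx * wy, wy * wx)})

/-- `E_m = var{x^m = 0}` (for `m ≥ 1`). -/
def Evar (m : ℕ) : SemigroupVariety :=
  varOf (zeroPairs (sPow wx (m - 1)) 1)

/-- `F = var{x²y = xyx = yx² = 0}`. -/
def Fvar : SemigroupVariety :=
  varOf (zeroPairs (wx * wx * wy) 2 ∪ zeroPairs (wx * wy * wx) 2 ∪
    zeroPairs (wy * (wx * wx)) 2)

/-- `H = var{x² = xyx = 0}`. -/
def Hvar : SemigroupVariety :=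
  varOf (zeroPairs (wx * wx) 1 ∪ zeroPairs (wx * wy * wx) 2)

/-- `C_0` is the trivial variety; `C_m = var{x^m = x^{m+1}, xy = yx}` for
`m ≥ 1` (the variety generated by the cyclic monoid `⟨a ∣ a^m = a^{m+1}⟩`). -/
def Cvar : ℕ → SemigroupVariety
  | 0 => varOf {(wx, wy)}
  | m + 1 => varOf {(sPow wx m, sPow wx (m + 1)), (wx * wy, wy * wx)}

/-! ### Duality -/

/-- The reverse of a word. -/
def revWord (w : SgWord) : SgWord :=
  MulOpposite.unop (FreeSemigroup.lift (fun x => MulOpposite.op (of x)) w)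

theorem revWord_of (x : ℕ) : revWord (of x) = of x := by
  simp [revWord]

theorem revWord_mul (u v : SgWord) : revWord (u * v) = revWord v * revWord u := by
  simp [revWord]

theorem lift_op {S : Type} [Semigroup S] (g : ℕ → S) (w : SgWord) :
    FreeSemigroup.lift (fun x => MulOpposite.op (g x)) w
      = MulOpposite.op (FreeSemigroup.lift g (revWord w)) := by
  induction w using FreeSemigroup.recOnMul with
  | ih1 x => simp [revWord_of]
  | ih2 x y ih1 ih2 => simp [revWord_mul, revWord_of, map_mul, ih2]

theorem satIdent_op_iff {S : Type} [Semigroup S] (e : SgEq) :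
    SatIdent Sᵐᵒᵖ e ↔ SatIdent S (revWord e.1, revWord e.2) := by
  constructor
  · intro h f
    have h1 := h fun x => MulOpposite.op (f x)
    rw [lift_op, lift_op] at h1
    exact MulOpposite.op_injective h1
  · intro h g
    have h1 : g = fun x => MulOpposite.op (MulOpposite.unop (g x)) := by
      funext x; simp
    rw [h1, lift_op, lift_op]
    exact congrArg _ (h fun x => MulOpposite.unop (g x))

/-- The set of identities of the dual variety: `e` holds in the dual of `V`
iff the reversed identity holds in `V`. -/
def dualIds (E : Set SgEq) : Set SgEq := {e | (revWord e.1, revWord e.2) ∈ E}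

theorem dualIds_closed (T : SemigroupTheory) :
    eqClosure (dualIds T.val) = dualIds T.val := by
  refine Set.Subset.antisymm ?_ (subset_eqClosure _)
  intro e he
  show (revWord e.1, revWord e.2) ∈ T.val
  rw [← T.2]
  intro S instS hS
  have hop : ∀ e' ∈ dualIds T.val, SatIdent Sᵐᵒᵖ e' := by
    intro e' he'
    rw [satIdent_op_iff]
    exact hS _ he'
  exact (satIdent_op_iff e).mp (he Sᵐᵒᵖ inferInstance hop)

/-- The variety dual to `V`, consisting of the semigroups anti-isomorphic to
members of `V`. -/
def dualVariety (V : SemigroupVariety) : SemigroupVariety :=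
  OrderDual.toDual ⟨dualIds (OrderDual.ofDual V).val, dualIds_closed _⟩

/-! ### The variety generated by a semigroup -/

/-- The equational theory of a semigroup `S`. -/
def theoryOf (S : Type) [Semigroup S] : Set SgEq := {e | SatIdent S e}

theorem theoryOf_closed (S : Type) [inst : Semigroup S] :
    eqClosure (theoryOf S) = theoryOf S := by
  refine Set.Subset.antisymm ?_ (subset_eqClosure _)
  intro e he
  exact he S inst fun e' he' => he'

/-- The variety generated by a semigroup `S`: the least variety containing `S`. -/
def varGeneratedBy (S : Type) [Semigroup S] : SemigroupVariety :=
  OrderDual.toDual ⟨theoryOf S, theoryOf_closed S⟩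

/-! ### Semantic properties of semigroups and of varieties -/

/-- A periodic semigroup: every element has two equal distinct powers. -/
def IsPeriodicSemigroup (S : Type) [Semigroup S] : Prop :=
  ∀ a : S, ∃ m n : ℕ, m < n ∧ sPow a m = sPow a n

/-- A zero element of a semigroup. -/
def IsZeroElem {S : Type} [Semigroup S] (z : S) : Prop :=
  ∀ a : S, z * a = z ∧ a * z = z

/-- A nil-semigroup: a semigroup with zero in which some power of every
element is zero. -/
def IsNilSemigroup (S : Type) [Semigroup S] : Prop :=
  ∃ z : S, IsZeroElem z ∧ ∀ a : S, ∃ n : ℕ, sPow a n = z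

/-- A semigroup is nilpotent of degree at most `k` if all products of at
least `k` elements coincide (and are then a zero element). -/
def IsNilpotentLe (S : Type) [Semigroup S] (k : ℕ) : Prop :=
  ∃ z : S, ∀ (a : S) (l : List S), k ≤ l.length + 1 → sProd a l = z

/-- A nilpotent semigroup. -/
def IsNilpotentSemigroup (S : Type) [Semigroup S] : Prop :=
  ∃ k : ℕ, IsNilpotentLe S k

/-- A completely regular semigroup: a union of groups; equivalently every
element `a` has an inverse commuting with `a`. -/
def IsCompletelyRegularSemigroup (S : Type) [Semigroup S] : Prop :=
  ∀ a : S, ∃ x : S, a = a * x * a ∧ a * x = x * a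

/-- A (two-sided) ideal of a semigroup. -/
def IsIdeal {S : Type} [Semigroup S] (I : Set S) : Prop :=
  ∀ a ∈ I, ∀ s : S, s * a ∈ I ∧ a * s ∈ I

/-- A simple semigroup: no proper nonempty ideals. -/
def IsSimpleSemigroup (S : Type) [Semigroup S] : Prop :=
  ∀ I : Set S, I.Nonempty → IsIdeal I → I = Set.univ

/-- A completely simple semigroup: a simple semigroup possessing a primitive
idempotent. -/
def IsCompletelySimpleSemigroup (S : Type) [Semigroup S] : Prop :=
  IsSimpleSemigroup S ∧
    ∃ e : S, e * e = e ∧ ∀ f : S, f * f = f → f * e = f → e * f = f → f = e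

/-- A semigroup which is a group. -/
def IsGroupSemigroup (S : Type) [Semigroup S] : Prop :=
  ∃ e : S, (∀ a : S, e * a = a ∧ a * e = a) ∧ ∀ a : S, ∃ b : S, a * b = e ∧ b * a = e

/-- A subset of a semigroup which is a subgroup. -/
def IsSubgroupSet {S : Type} [Semigroup S] (G : Set S) : Prop :=
  (∀ a ∈ G, ∀ b ∈ G, a * b ∈ G) ∧
    ∃ e ∈ G, (∀ a ∈ G, e * a = a ∧ a * e = a) ∧
      ∀ a ∈ G, ∃ b ∈ G, a * b = e ∧ b * a = e

/-- A periodic variety: all members are periodic semigroups. -/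
def IsPeriodicVariety (V : SemigroupVariety) : Prop :=
  ∀ (S : Type) [Semigroup S], MemVar S V → IsPeriodicSemigroup S

/-- A nil-variety: all members are nil-semigroups. -/
def IsNilVariety (V : SemigroupVariety) : Prop :=
  ∀ (S : Type) [Semigroup S], MemVar S V → IsNilSemigroup S

/-- A completely regular variety: all members are completely regular. -/
def IsCompletelyRegularVariety (V : SemigroupVariety) : Prop :=
  ∀ (S : Type) [Semigroup S], MemVar S V → IsCompletelyRegularSemigroup S

/-- A completely simple variety: all members are completely simple. -/
def IsCompletelySimpleVariety (V : SemigroupVariety) : Prop :=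
  ∀ (S : Type) [Semigroup S], MemVar S V → IsCompletelySimpleSemigroup S

/-- A periodic group variety: all members are periodic groups. -/
def IsPeriodicGroupVariety (V : SemigroupVariety) : Prop :=
  ∀ (S : Type) [Semigroup S], MemVar S V → IsGroupSemigroup S ∧ IsPeriodicSemigroup S

/-- A combinatorial variety: all subgroups of all members are trivial. -/
def IsCombinatorialVariety (V : SemigroupVariety) : Prop :=
  ∀ (S : Type) [Semigroup S], MemVar S V →
    ∀ G : Set S, IsSubgroupSet G → G.Subsingleton

/-- An Abelian periodic group variety: all members are Abelian periodic groups. -/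
def IsAbelianPeriodicGroupVariety (V : SemigroupVariety) : Prop :=
  ∀ (S : Type) [Semigroup S], MemVar S V →
    IsGroupSemigroup S ∧ (∀ a b : S, a * b = b * a) ∧ IsPeriodicSemigroup S

/-- A chain variety: the lattice of its subvarieties is a chain. -/
def IsChainVariety (V : SemigroupVariety) : Prop :=
  ∀ W₁ W₂ : SemigroupVariety, W₁ ≤ V → W₂ ≤ V → W₁ ≤ W₂ ∨ W₂ ≤ W₁

/-! ### Degrees, nilpotency, completely regular powers -/

/-- A variety of finite degree: all its nil-members are nilpotent. -/
def IsFiniteDegreeVariety (V : SemigroupVariety) : Prop :=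
  ∀ (S : Type) [Semigroup S], MemVar S V → IsNilSemigroup S → IsNilpotentSemigroup S

/-- The nilpotency degrees of nil-members of `V` are bounded by `k`. -/
def DegreeBoundedBy (V : SemigroupVariety) (k : ℕ) : Prop :=
  ∀ (S : Type) [Semigroup S], MemVar S V → IsNilSemigroup S → IsNilpotentLe S k

/-- `V` is a variety of degree `k`: the nilpotency degrees of its nil-members
are bounded by `k` and `k` is the least such (positive) number. -/
def HasDegree (V : SemigroupVariety) (k : ℕ) : Prop :=
  DegreeBoundedBy V k ∧ ∀ j : ℕ, 1 ≤ j → j < k → ¬ DegreeBoundedBy V j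

/-- A nilpotent variety: one satisfying an identity `x₁x₂⋯x_k = 0`. -/
def IsNilpotentVariety (V : SemigroupVariety) : Prop :=
  ∃ k : ℕ, 1 ≤ k ∧ zeroPairs (wordOfList (List.range k)) k ⊆ V.ids

/-- The `k`-th power of a semigroup `S`: the set of products of `k` elements. -/
def powSet (S : Type) [Semigroup S] (k : ℕ) : Set S :=
  {s | ∃ (a : S) (l : List S), l.length + 1 = k ∧ s = sProd a l}

/-- The `k`-th power of `S` is a completely regular subsemigroup. -/
def HasCRPow (S : Type) [Semigroup S] (k : ℕ) : Prop :=
  ∀ a ∈ powSet S k, ∃ x ∈ powSet S k, a = a * x * a ∧ a * x = x * a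

/-- All members of `V` have completely regular `k`-th power. -/
def CRPowAll (V : SemigroupVariety) (k : ℕ) : Prop :=
  ∀ (S : Type) [Semigroup S], MemVar S V → HasCRPow S k

/-- A variety of semigroups with completely regular power. -/
def IsCRPowerVariety (V : SemigroupVariety) : Prop :=
  ∀ (S : Type) [Semigroup S], MemVar S V → ∃ n : ℕ, 1 ≤ n ∧ HasCRPow S n

/-- A variety of semigroups with completely regular `k`-th power: `S^k` is
completely regular for every member `S`, and `k` is the least such (positive)
number. -/
def IsCRkPowerVariety (V : SemigroupVariety) (k : ℕ) : Prop :=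
  CRPowAll V k ∧ ∀ j : ℕ, 1 ≤ j → j < k → ¬ CRPowAll V j

/-! ### Permutational identities -/

/-- The permutational identity `x₁x₂⋯x_n = x_{1α}x_{2α}⋯x_{nα}` of length `n`
determined by a non-trivial permutation `α` of `{1, …, n}`. -/
def IsPermIdentOfLength (n : ℕ) (e : SgEq) : Prop :=
  ∃ σ : Equiv.Perm (Fin n), σ ≠ 1 ∧
    e = (wordOfList (List.ofFn fun i : Fin n => (i : ℕ)),
         wordOfList (List.ofFn fun i : Fin n => ((σ i : Fin n) : ℕ)))

/-- `PERM_n`: the variety given by all permutational identities of length `n`. -/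
def PERMvar (n : ℕ) : SemigroupVariety :=
  varOf {e | IsPermIdentOfLength n e}

/-- A permutative variety: one satisfying some permutational identity. -/
def IsPermutativeVariety (V : SemigroupVariety) : Prop :=
  ∃ (n : ℕ) (e : SgEq), IsPermIdentOfLength n e ∧ e ∈ V.ids

/-- A strongly permutative variety: one satisfying a permutational identity
with `1α ≠ 1` and `nα ≠ n`. -/
def IsStronglyPermutativeVariety (V : SemigroupVariety) : Prop :=
  ∃ (n : ℕ) (σ : Equiv.Perm (Fin (n + 2))),
    σ 0 ≠ 0 ∧ σ (Fin.last (n + 1)) ≠ Fin.last (n + 1) ∧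
    (wordOfList (List.ofFn fun i : Fin (n + 2) => (i : ℕ)),
     wordOfList (List.ofFn fun i : Fin (n + 2) => ((σ i : Fin (n + 2)) : ℕ))) ∈ V.ids

/-! ### Nil part and 0-reduced closure in Com -/

/-- `Nil(V)`: the greatest nil-subvariety of (a periodic variety) `V`. -/
def NilPart (V : SemigroupVariety) : SemigroupVariety :=
  sSup {W : SemigroupVariety | W ≤ V ∧ IsNilVariety W}

/-- `ZR(X)`: the least variety 0-reduced in **Com** containing `X`. -/
def ZRPart (X : SemigroupVariety) : SemigroupVariety :=
  sInf {W : SemigroupVariety | X ≤ W ∧ IsZeroReducedInCom W}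

/-! ### First-order formulas over lattices -/

section Formulas

open FirstOrder.Language

/-- The formula `t ≤ s`, expressed as `t ⊔ s = s`. -/
def leFormula {α : Type} {n : ℕ} (t s : latticeLang.Term (α ⊕ Fin n)) :
    latticeLang.BoundedFormula α n :=
  (Functions.apply₂ (L := latticeLang)
    (show latticeLang.Functions 2 from (0 : Fin 2)) t s).bdEqual s

theorem realize_leFormula {L : Type*} [Lattice L] {α : Type} {n : ℕ}
    (t s : latticeLang.Term (α ⊕ Fin n)) (v : α → L) (xs : Fin n → L) :
    (leFormula t s).Realize v xs ↔
      t.realize (Sum.elim v xs) ≤ s.realize (Sum.elim v xs) := by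
  rw [leFormula, BoundedFormula.realize_bdEqual, Term.realize_functions_apply₂, ← sup_eq_right]
  rfl

/-- The formula with bound variables `&0, …, &n` saying that `&n` is a least element. -/
def isBotFormula {α : Type} (n : ℕ) : latticeLang.BoundedFormula α (n + 1) :=
  (leFormula (n := n + 2) (Term.var (Sum.inr (Fin.last n).castSucc))
    (Term.var (Sum.inr (Fin.last (n + 1))))).all

theorem realize_isBotFormula {L : Type*} [Lattice L] [OrderBot L] {α : Type} {n : ℕ}
    (v : α → L) (xs : Fin (n + 1) → L) :
    (isBotFormula n).Realize v xs ↔ xs (Fin.last n) = ⊥ := by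
  rw [isBotFormula, BoundedFormula.realize_all, ← isBot_iff_eq_bot]
  simp only [realize_leFormula, Term.realize_var, Sum.elim_inr, Fin.snoc_castSucc, Fin.snoc_last]
  rfl

/-- The formula with bound variables `&0, …, &n` saying that `&n` is an atom. -/
def isAtomFormula {α : Type} (n : ℕ) : latticeLang.BoundedFormula α (n + 1) :=
  (isBotFormula n).not ⊓
    ((leFormula (n := n + 2) (Term.var (Sum.inr (Fin.last (n + 1))))
        (Term.var (Sum.inr (Fin.last n).castSucc))).imp
      ((Term.var (Sum.inr (Fin.last (n + 1)))).bdEqual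
        (Term.var (Sum.inr (Fin.last n).castSucc)) ⊔ isBotFormula (n + 1))).all

theorem realize_isAtomFormula {L : Type*} [Lattice L] [OrderBot L] {α : Type} {n : ℕ}
    (v : α → L) (xs : Fin (n + 1) → L) :
    (isAtomFormula n).Realize v xs ↔ IsAtom (xs (Fin.last n)) := by
  simp only [isAtomFormula, BoundedFormula.realize_inf, BoundedFormula.realize_not,
    BoundedFormula.realize_all, BoundedFormula.realize_imp, BoundedFormula.realize_sup,
    BoundedFormula.realize_bdEqual, realize_leFormula, realize_isBotFormula, Term.realize_var,
    Sum.elim_inr, Fin.snoc_castSucc, Fin.snoc_last]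
  refine and_congr_right fun _ => forall_congr' fun d => ?_
  rw [lt_iff_le_and_ne]
  tauto

/-- An element is above all but at most two atoms. -/
def AboveAllAtomsButTwo {L : Type*} [Lattice L] [OrderBot L] (x : L) : Prop :=
  ∃ a b : L, ∀ c : L, IsAtom c → c = a ∨ c = b ∨ c ≤ x

/-- The formula saying that `&0` is above all but at most two atoms. -/
def aboveAllAtomsButTwoFormula {α : Type} : latticeLang.BoundedFormula α 1 :=
  ((isAtomFormula 3).imp
    ((&3).bdEqual (&1) ⊔ ((&3).bdEqual (&2) ⊔ leFormula (n := 4) (&3) (&0)))).all.ex.ex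

theorem realize_aboveAllAtomsButTwoFormula {L : Type*} [Lattice L] [OrderBot L] {α : Type}
    (v : α → L) (xs : Fin 1 → L) :
    aboveAllAtomsButTwoFormula.Realize v xs ↔ AboveAllAtomsButTwo (xs 0) := by
  simp only [aboveAllAtomsButTwoFormula, BoundedFormula.realize_ex, BoundedFormula.realize_all,
    BoundedFormula.realize_imp, BoundedFormula.realize_sup, BoundedFormula.realize_bdEqual,
    realize_leFormula, realize_isAtomFormula]
  rfl

theorem isDefinableIn_aboveAllAtomsButTwo {L : Type*} [Lattice L] [OrderBot L] :
    IsDefinableIn L {x | AboveAllAtomsButTwo x} := by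
  refine ⟨((Term.var (Sum.inl 0)).bdEqual (&0) ⊓ aboveAllAtomsButTwoFormula).ex, fun a => ?_⟩
  simp [Formula.Realize, realize_aboveAllAtomsButTwoFormula, Fin.snoc]

theorem isDefinableIn_lowerBounds_aboveAllAtomsButTwo {L : Type*} [Lattice L] [OrderBot L] :
    IsDefinableIn L (lowerBounds {x | AboveAllAtomsButTwo x}) := by
  refine ⟨(aboveAllAtomsButTwoFormula.imp
    (leFormula (n := 1) (Term.var (Sum.inl 0)) (&0))).all, fun a => ?_⟩
  simp [Formula.Realize, realize_aboveAllAtomsButTwoFormula, realize_leFormula, Fin.snoc,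
    lowerBounds]

theorem IsDefinableIn.compl {L : Type*} [Lattice L] {A : Set L} (h : IsDefinableIn L A) :
    IsDefinableIn L Aᶜ := by
  obtain ⟨φ, hφ⟩ := h
  exact ⟨φ.not, fun a => by rw [Formula.realize_not, hφ]; rfl⟩

end Formulas

/-! ### Varieties generated by a semigroup -/

theorem varGeneratedBy_le_iff {S : Type} [Semigroup S] {V : SemigroupVariety} :
    varGeneratedBy S ≤ V ↔ MemVar S V := Iff.rfl

theorem mem_ids_of_forall_memVar {V : SemigroupVariety} {e : SgEq}
    (h : ∀ (S : Type) [Semigroup S], MemVar S V → SatIdent S e) : e ∈ V.ids := by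
  have : eqClosure V.ids = V.ids := (OrderDual.ofDual V).2
  rw [← this]
  exact fun S inst hS => h S hS

theorem ne_bot_of_memVar {S : Type} [Semigroup S] [Nontrivial S] {V : SemigroupVariety}
    (h : MemVar S V) : V ≠ ⊥ := by
  rintro rfl
  obtain ⟨a, b, hab⟩ := exists_pair_ne S
  have htriv : (⊥ : SemigroupVariety) ≤ OrderDual.toDual ⟨Set.univ,
      Set.Subset.antisymm (Set.subset_univ _) (subset_eqClosure _)⟩ := bot_le
  have := h (of 0, of 1) (htriv (Set.mem_univ _)) fun n => if n = 0 then a else b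
  exact hab (by simpa using this)

theorem eq_bot_of_forall_subsingleton {V : SemigroupVariety}
    (h : ∀ (S : Type) [Semigroup S], MemVar S V → Subsingleton S) : V = ⊥ :=
  eq_bot_iff.2 fun _ _ => mem_ids_of_forall_memVar fun S _ hS _ =>
    (h S hS).elim _ _

theorem eq_varGeneratedBy_of_isAtom {S : Type} [Semigroup S] [Nontrivial S]
    {V : SemigroupVariety} (hV : IsAtom V) (h : MemVar S V) : V = varGeneratedBy S :=
  ((hV.le_iff_eq (ne_bot_of_memVar (S := S) (varGeneratedBy_le_iff.1 le_rfl))).1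
    (varGeneratedBy_le_iff.2 h)).symm

theorem satIdent_comm_iff {S : Type} [Semigroup S] :
    SatIdent S (wx * wy, wy * wx) ↔ ∀ a b : S, a * b = b * a := by
  constructor
  · intro h a b
    simpa [wx, wy] using h fun n => if n = 0 then a else b
  · intro h f
    simpa [wx, wy] using h _ _

theorem le_COMvar_iff {V : SemigroupVariety} : V ≤ COMvar ↔ (wx * wy, wy * wx) ∈ V.ids :=
  (theoryGC _ (OrderDual.ofDual V)).trans Set.singleton_subset_iff

theorem COMvar_le_iff {V : SemigroupVariety} :
    COMvar ≤ V ↔ ∀ (S : Type) [Semigroup S], (∀ a b : S, a * b = b * a) → MemVar S V := by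
  constructor
  · intro h S inst hS e he
    refine h he S inst fun e' he' => ?_
    rw [Set.mem_singleton_iff.1 he']
    exact satIdent_comm_iff.2 hS
  · intro h e he S inst hS
    exact h S (satIdent_comm_iff.1 (hS _ rfl)) e he

theorem varGeneratedBy_le_COMvar {S : Type} [Semigroup S] (h : ∀ a b : S, a * b = b * a) :
    varGeneratedBy S ≤ COMvar :=
  le_COMvar_iff.2 (satIdent_comm_iff.2 h)

/-! ### Noncommutative atoms -/

/-- The two-element left zero semigroup. -/
def LeftZeroTwo : Type := Bool

instance : Semigroup LeftZeroTwo where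
  mul a _ := a
  mul_assoc _ _ _ := rfl

instance : Nontrivial LeftZeroTwo := inferInstanceAs (Nontrivial Bool)

/-- The two-element right zero semigroup. -/
def RightZeroTwo : Type := Bool

instance : Semigroup RightZeroTwo where
  mul _ b := b
  mul_assoc _ _ _ := rfl

instance : Nontrivial RightZeroTwo := inferInstanceAs (Nontrivial Bool)

/-- The two-element semilattice. -/
def SemilatticeTwo : Type := Bool

instance : Semigroup SemilatticeTwo where
  mul := and
  mul_assoc := Bool.and_assoc

instance : Nontrivial SemilatticeTwo := inferInstanceAs (Nontrivial Bool)

theorem exists_failing_ident {S : Type} [Semigroup S] {V : SemigroupVariety}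
    (h : ¬ MemVar S V) : ∃ e ∈ V.ids, ∃ f : ℕ → S, lift f e.1 ≠ lift f e.2 := by
  simpa [MemVar, SatIdent] using h

section Band

variable {S : Type} [Semigroup S]

theorem lift_band_cases (hid : ∀ a : S, a * a = a) (a b : S) (f : ℕ → SemilatticeTwo)
    (w : SgWord) :
    (lift f w = true ∧ lift (fun n => cond (f n) b a) w = b) ∨
    (lift f w = false ∧ b * lift (fun n => cond (f n) b a) w * b = b * a * b ∧
      a * lift (fun n => cond (f n) b a) w * b = a * b) := by
  have hid' : ∀ a c : S, a * (a * c) = a * c := fun a c => by rw [← mul_assoc, hid]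
  induction w using FreeSemigroup.recOnMul with
  | ih1 x =>
    rcases Bool.eq_false_or_eq_true (f x) with hx | hx
    · exact .inl ⟨by rw [lift_of, hx], by rw [lift_of, hx]; rfl⟩
    · refine .inr ⟨by rw [lift_of, hx], ?_⟩
      rw [lift_of, hx]
      exact ⟨rfl, by rw [cond_false, hid]⟩
  | ih2 x y ih1 ih2 =>
    simp only [map_mul, lift_of]
    generalize lift (fun n => cond (f n) b a) y = c at ih2 ⊢
    rcases Bool.eq_false_or_eq_true (f x) with hx | hx <;> rw [hx] <;>
      rcases ih2 with ⟨h1, rfl⟩ | ⟨h1, h2, h3⟩ <;> rw [h1]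
    · exact .inl ⟨rfl, hid _⟩
    · simp only [mul_assoc] at h2 h3
      refine .inr ⟨rfl, by simp only [cond_true, mul_assoc, hid', h2], ?_⟩
      rw [cond_true, mul_assoc, mul_assoc, h2, ← mul_assoc, ← mul_assoc, mul_assoc, hid]
    · exact .inr ⟨rfl, by simp only [cond_false, mul_assoc, hid],
        by simp only [cond_false, mul_assoc, hid, hid']⟩
    · simp only [mul_assoc] at h2 h3
      exact .inr ⟨rfl, by simp only [cond_false, mul_assoc, h3],
        by simp only [cond_false, mul_assoc, hid', h3]⟩

theorem band_mul_mul_self_of_memVar {V : SemigroupVariety} (hS : MemVar S V)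
    (hV : ¬ MemVar SemilatticeTwo V) (hid : ∀ a : S, a * a = a) (a b : S) : b * a * b = b := by
  obtain ⟨e, he, f, hf⟩ := exists_failing_ident hV
  have h := hS e he fun n => cond (f n) b a
  rcases lift_band_cases hid a b f e.1 with ⟨h1, h2⟩ | ⟨h1, h2, -⟩ <;>
    rcases lift_band_cases hid a b f e.2 with ⟨h3, h4⟩ | ⟨h3, h4, -⟩
  · exact absurd (h1.trans h3.symm) hf
  · rw [← h4, ← h, h2, hid, hid]
  · rw [← h2, h, h4, hid, hid]
  · exact absurd (h1.trans h3.symm) hf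

theorem mul_mul_eq_mul_of_rectangular (hr : ∀ a b : S, b * a * b = b) (a b c : S) :
    a * b * c = a * c := by
  calc a * b * c = a * b * (c * a * c) := by rw [hr]
    _ = a * (b * c) * a * c := by simp only [mul_assoc]
    _ = a * c := by rw [hr]

theorem lift_leftZeroTwo (f : ℕ → LeftZeroTwo) (w : SgWord) : lift f w = f w.head := by
  induction w using FreeSemigroup.recOnMul with
  | ih1 x => simp
  | ih2 x y ih1 ih2 => rw [map_mul]; exact ih1

theorem lift_mul_of_rectangular (hr : ∀ a b : S, b * a * b = b) (g : ℕ → S) (w : SgWord)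
    (b : S) : lift g w * b = g w.head * b := by
  induction w using FreeSemigroup.recOnMul with
  | ih1 x => simp
  | ih2 x y ih1 ih2 =>
    rw [map_mul, mul_mul_eq_mul_of_rectangular hr]; exact ih1

theorem mul_eq_right_of_memVar {V : SemigroupVariety} (hS : MemVar S V)
    (hV : ¬ MemVar LeftZeroTwo V) (hid : ∀ a : S, a * a = a) (hr : ∀ a b : S, b * a * b = b)
    (a b : S) : a * b = b := by
  obtain ⟨e, he, f, hf⟩ := exists_failing_ident hV
  have h := congrArg (· * b) (hS e he fun n => cond (f n) b a)
  simp only [lift_mul_of_rectangular hr] at h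
  rw [lift_leftZeroTwo, lift_leftZeroTwo] at hf
  have key : ∀ p q : Bool, p ≠ q → cond p b a * b = cond q b a * b → a * b = b := by
    rintro (_ | _) (_ | _) <;> simp only [cond_true, cond_false, hid, eq_comm (a := b)] <;> simp
  exact key _ _ hf h

theorem exists_last_letter (hr : ∀ a b : S, b * a * b = b) (w : SgWord) :
    ∃ n : ℕ, (∀ f : ℕ → RightZeroTwo, lift f w = f n) ∧
      ∀ (g : ℕ → S) (b : S), b * lift g w = b * g n := by
  induction w using FreeSemigroup.recOnMul with
  | ih1 x => exact ⟨x, by simp, by simp⟩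
  | ih2 x y ih1 ih2 =>
    obtain ⟨n, h1, h2⟩ := ih2
    refine ⟨n, fun f => ?_, fun g b => ?_⟩
    · rw [map_mul]; exact h1 f
    · rw [map_mul, ← mul_assoc, mul_mul_eq_mul_of_rectangular hr, h2]

theorem mul_eq_left_of_memVar {V : SemigroupVariety} (hS : MemVar S V)
    (hV : ¬ MemVar RightZeroTwo V) (hid : ∀ a : S, a * a = a) (hr : ∀ a b : S, b * a * b = b)
    (a b : S) : b * a = b := by
  obtain ⟨e, he, f, hf⟩ := exists_failing_ident hV
  obtain ⟨m, hm, hm'⟩ := exists_last_letter hr e.1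
  obtain ⟨n, hn, hn'⟩ := exists_last_letter hr e.2
  have h := congrArg (b * ·) (hS e he fun n => cond (f n) b a)
  simp only [hm', hn'] at h
  rw [hm, hn] at hf
  have key : ∀ p q : Bool, p ≠ q → b * cond p b a = b * cond q b a → b * a = b := by
    rintro (_ | _) (_ | _) <;> simp only [cond_true, cond_false, hid, eq_comm (a := b)] <;> simp
  exact key _ _ hf h

theorem subsingleton_of_band {V : SemigroupVariety} (hS : MemVar S V)
    (hSL : ¬ MemVar SemilatticeTwo V) (hL : ¬ MemVar LeftZeroTwo V)
    (hR : ¬ MemVar RightZeroTwo V) (hid : ∀ a : S, a * a = a) : Subsingleton S := by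
  have hr := band_mul_mul_self_of_memVar hS hSL hid
  exact ⟨fun a b => (mul_eq_left_of_memVar hS hR hid hr b a).symm.trans
    (mul_eq_right_of_memVar hS hL hid hr a b)⟩

end Band

theorem MemVar.subsemigroup {S : Type} [Semigroup S] {V : SemigroupVariety} (h : MemVar S V)
    (T : Subsemigroup S) : MemVar T V := by
  intro e he f
  have hom : ∀ w : SgWord, ((lift f w : T) : S) = lift (fun n => (f n : S)) w := fun w => by
    induction w using FreeSemigroup.recOnMul with
    | ih1 x => simp
    | ih2 x y ih1 ih2 => simp [ih2]
  exact Subtype.ext (by rw [hom, hom]; exact h e he _)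

theorem eq_or_eq_or_le_COMvar_of_isAtom {V : SemigroupVariety} (hV : IsAtom V) :
    V = varGeneratedBy LeftZeroTwo ∨ V = varGeneratedBy RightZeroTwo ∨ V ≤ COMvar := by
  by_contra! hne
  obtain ⟨hL, hR, hC⟩ := hne
  have hcomm : ∀ (S : Type) [Semigroup S], MemVar S V → (∀ a b : S, a * b = b * a) →
      Subsingleton S := by
    intro S _ hS hab
    by_contra hn
    rw [not_subsingleton_iff_nontrivial] at hn
    exact hC ((eq_varGeneratedBy_of_isAtom hV hS).trans_le (varGeneratedBy_le_COMvar hab))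
  refine hV.1 (eq_bot_of_forall_subsingleton fun S _ hS => subsingleton_of_band hS ?_
    (fun h => hL (eq_varGeneratedBy_of_isAtom hV h))
    (fun h => hR (eq_varGeneratedBy_of_isAtom hV h)) fun a => ?_)
  · intro h
    exact not_subsingleton SemilatticeTwo (hcomm _ h Bool.and_comm)
  · let T := Subsemigroup.closure {a}
    have ha : a ∈ T := Subsemigroup.subset_closure rfl
    have := hcomm T (hS.subsemigroup T) fun x y =>
      have := Subsemigroup.isMulCommutative_closure S (s := {a}) (by simp)
      mul_comm' x y
    exact congrArg Subtype.val (Subsingleton.elim (⟨a * a, T.mul_mem ha ha⟩ : T) ⟨a, ha⟩)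

theorem aboveAllAtomsButTwo_of_COMvar_le {V : SemigroupVariety} (hV : COMvar ≤ V) :
    AboveAllAtomsButTwo V :=
  ⟨_, _, fun _ hc => (eq_or_eq_or_le_COMvar_of_isAtom hc).imp_right (Or.imp_right hV.trans')⟩

/-! ### Powers and letter contents -/

theorem sPow_mul_sPow {S : Type*} [Semigroup S] (a : S) (m n : ℕ) :
    sPow a m * sPow a n = sPow a (m + n + 1) := by
  induction n with
  | zero => rfl
  | succ n ih => rw [sPow, ← mul_assoc, ih]; rfl

theorem map_sPow {S T F : Type*} [Mul S] [Mul T] [FunLike F S T] [MulHomClass F S T] (φ : F)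
    (a : S) (n : ℕ) : φ (sPow a n) = sPow (φ a) n := by
  induction n with
  | zero => rfl
  | succ n ih => rw [sPow, map_mul, ih]; rfl

theorem sPow_eq_pow {M : Type*} [Monoid M] (a : M) (n : ℕ) : sPow a n = a ^ (n + 1) := by
  induction n with
  | zero => simp [sPow]
  | succ n ih => rw [sPow, ih, ← pow_succ]

/-- The multiset of letters of a word. -/
def letters (w : SgWord) : Multiset ℕ := w.head ::ₘ (w.tail : Multiset ℕ)

theorem letters_of (x : ℕ) : letters (of x) = {x} := rfl

theorem letters_mul (u v : SgWord) : letters (u * v) = letters u + letters v := by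
  simp only [letters, head_mul, tail_mul, Multiset.cons_add, ← Multiset.coe_add,
    ← Multiset.cons_coe]

theorem sum_map_indicator {R : Type*} [AddCommMonoidWithOne R] (s : Multiset ℕ) (x : ℕ) :
    (s.map fun n => if n = x then (1 : R) else 0).sum = s.count x := by
  induction s using Multiset.induction with
  | empty => simp
  | cons a s ih =>
    rw [Multiset.map_cons, Multiset.sum_cons, ih, Multiset.count_cons]
    by_cases h : a = x
    · simp [h, add_comm]
    · simp [h, Ne.symm h]

theorem lift_commMonoid {M : Type*} [CommMonoid M] (f : ℕ → M) (w : SgWord) :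
    lift f w = ((letters w).map f).prod := by
  induction w using FreeSemigroup.recOnMul with
  | ih1 x => simp [letters_of]
  | ih2 x y ih1 ih2 => simp [letters_mul, letters_of, ih2]

theorem satIdent_of_letters_eq {S : Type} [Semigroup S] (hS : ∀ a b : S, a * b = b * a)
    {e : SgEq} (he : letters e.1 = letters e.2) : SatIdent S e := by
  let _ : CommSemigroup S := { mul_comm := hS }
  intro f
  have hom : ∀ w : SgWord, ((lift f w : S) : WithOne S) = lift (fun n => (f n : WithOne S)) w :=
    fun w => DFunLike.congr_fun (FreeSemigroup.hom_ext (f := WithOne.coeMulHom.comp (lift f))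
      (g := lift fun n => (f n : WithOne S)) (by ext; simp)) w
  apply WithOne.coe_injective
  rw [hom, hom, lift_commMonoid, lift_commMonoid, he]

theorem exists_lift_sPow_eq {S : Type} [Semigroup S] (a : S) (k : ℕ → ℕ) (w : SgWord) :
    ∃ m, lift (fun n => sPow a (k n)) w = sPow a m ∧
      m + 1 = ((letters w).map fun n => k n + 1).sum := by
  induction w using FreeSemigroup.recOnMul with
  | ih1 x => exact ⟨k x, by simp [letters_of]⟩
  | ih2 x y ih1 ih2 =>
    obtain ⟨m, h1, h2⟩ := ih2
    refine ⟨k x + m + 1, by simp [h1, sPow_mul_sPow], ?_⟩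
    rw [letters_mul, Multiset.map_add, Multiset.sum_add, ← h2]
    simp [letters_of]
    ring

/-! ### Periodic varieties -/

theorem isPeriodicSemigroup_of_letters_ne {S : Type} [Semigroup S] {e : SgEq}
    (hS : SatIdent S e) (he : letters e.1 ≠ letters e.2) : IsPeriodicSemigroup S := by
  intro a
  suffices ∃ m n : ℕ, m ≠ n ∧ sPow a m = sPow a n by
    obtain ⟨m, n, hmn, h⟩ := this
    rcases hmn.lt_or_gt with hlt | hlt
    exacts [⟨m, n, hlt, h⟩, ⟨n, m, hlt, h.symm⟩]
  obtain ⟨k, hk⟩ : ∃ k : ℕ → ℕ, ((letters e.1).map fun n => k n + 1).sum ≠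
      ((letters e.2).map fun n => k n + 1).sum := by
    by_contra! h
    have hcard := h 0
    refine he (Multiset.ext.2 fun x => ?_)
    have hx := h fun n => if n = x then 1 else 0
    rw [Multiset.sum_map_add, Multiset.sum_map_add, sum_map_indicator, sum_map_indicator] at hx
    simp only [zero_add, Pi.zero_apply] at hcard
    rw [hcard] at hx
    exact Nat.add_right_cancel hx
  obtain ⟨m, h1, h2⟩ := exists_lift_sPow_eq a k e.1
  obtain ⟨n, h3, h4⟩ := exists_lift_sPow_eq a k e.2
  refine ⟨m, n, by omega, ?_⟩
  rw [← h1, ← h3]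
  exact hS _

theorem isPeriodicVariety_iff {V : SemigroupVariety} :
    IsPeriodicVariety V ↔ ¬ COMvar ≤ V := by
  constructor
  · intro hV hC
    obtain ⟨m, n, hmn, h⟩ := hV (Multiplicative ℕ) (COMvar_le_iff.1 hC _ mul_comm)
      (Multiplicative.ofAdd 1)
    rw [sPow_eq_pow, sPow_eq_pow, ← ofAdd_nsmul, ← ofAdd_nsmul] at h
    have := Multiplicative.ofAdd.injective h
    simp at this
    omega
  · intro hC S _ hS
    rw [COMvar_le_iff] at hC
    push Not at hC
    obtain ⟨T, _, hT, hTV⟩ := hC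
    obtain ⟨e, he, f, hf⟩ := exists_failing_ident hTV
    exact isPeriodicSemigroup_of_letters_ne (hS e he) fun h =>
      hf (satIdent_of_letters_eq hT h f)

/-! ### Varieties of abelian groups of prime exponent -/

/-- The variety generated by the cyclic group of order `p`. -/
def cyclicVar (p : ℕ) : SemigroupVariety := varGeneratedBy (Multiplicative (ZMod p))

theorem sPow_mul_mem_cyclicVar (p : ℕ) (hp : 0 < p) :
    (sPow wx (p - 1) * wy, wy) ∈ (cyclicVar p).ids := by
  intro f
  simp only [map_mul, map_sPow, sPow_eq_pow, Nat.sub_add_cancel hp]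
  rw [← ofAdd_toAdd (lift f wx), ← ofAdd_nsmul]
  simp

theorem dvd_of_cyclicVar_le {p q : ℕ} (hp : 0 < p) (h : cyclicVar q ≤ cyclicVar p) : q ∣ p := by
  have := h (sPow_mul_mem_cyclicVar p hp) fun n => Multiplicative.ofAdd (if n = 0 then 1 else 0)
  simp only [map_mul, map_sPow, sPow_eq_pow, Nat.sub_add_cancel hp] at this
  rw [mul_eq_right] at this
  have := congrArg Multiplicative.toAdd this
  simpa [wx, ZMod.natCast_eq_zero_iff] using this

theorem subsingleton_of_memVar_of_lt_cyclicVar {p : ℕ} [Fact p.Prime] {W : SemigroupVariety}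
    (hW : W < cyclicVar p) {S : Type} [Semigroup S] (hS : MemVar S W) : Subsingleton S := by
  have hp : 0 < p := (Fact.out : p.Prime).pos
  have hpow : ∀ a b : S, sPow a (p - 1) * b = b := fun a b => by
    simpa [wx, wy, map_sPow] using
      hS _ (hW.le (sPow_mul_mem_cyclicVar p hp)) fun n => if n = 0 then a else b
  have hcomm : ∀ a b : S, a * b = b * a := satIdent_comm_iff.1
    (hS _ (hW.le (satIdent_comm_iff.2 mul_comm)))
  obtain ⟨e, he, f, hf⟩ := exists_failing_ident (fun h => hW.not_ge (varGeneratedBy_le_iff.2 h))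
  let L : S →ₙ* Function.End S := ⟨fun a b => a * b, fun a b => funext fun c => mul_assoc a b c⟩
  have hL : ∀ a, L a = 1 := by
    intro a
    have ha : L a ^ p = 1 := by
      rw [← Nat.sub_add_cancel hp, ← sPow_eq_pow, ← map_sPow]
      exact funext (hpow a)
    by_contra hne
    have hord := orderOf_eq_prime ha hne
    let ψ : Multiplicative (ZMod p) →* Function.End S :=
      { toFun := fun k => L a ^ (k.toAdd).val
        map_one' := by simp
        map_mul' := fun x y => by
          rw [toAdd_mul, ZMod.val_add, ← pow_add, ← pow_eq_pow_mod _ ha] }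
    have hψ : ∀ w : SgWord,
        L (lift (fun n => sPow a ((f n).toAdd.val + p - 1)) w) = ψ (lift f w) := by
      intro w
      induction w using FreeSemigroup.recOnMul with
      | ih1 x =>
        simp only [lift_of, map_sPow, sPow_eq_pow]
        rw [Nat.sub_add_cancel (by omega), pow_add, ha, mul_one]
        rfl
      | ih2 x y ih1 ih2 => simp only [map_mul, ih1, ih2]
    have heq : L a ^ (lift f e.1).toAdd.val = L a ^ (lift f e.2).toAdd.val := by
      have := congrArg L (hS e he fun n => sPow a ((f n).toAdd.val + p - 1))
      rwa [hψ, hψ] at this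
    refine hf (Multiplicative.toAdd.injective (ZMod.val_injective p
      (pow_injOn_Iio_orderOf ?_ ?_ heq))) <;>
    · rw [hord]; exact ZMod.val_lt _
  have hmul : ∀ a b : S, a * b = b := fun a b => congrFun (hL a) b
  exact ⟨fun a b => (hmul b a).symm.trans ((hcomm b a).trans (hmul a b))⟩

theorem isAtom_cyclicVar (p : ℕ) [Fact p.Prime] : IsAtom (cyclicVar p) :=
  ⟨ne_bot_of_memVar (S := Multiplicative (ZMod p)) (varGeneratedBy_le_iff.1 le_rfl),
    fun _ hW => eq_bot_of_forall_subsingleton fun _ _ hS =>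
      subsingleton_of_memVar_of_lt_cyclicVar hW hS⟩

theorem count_modEq_of_cyclicVar_le {p : ℕ} {V : SemigroupVariety} (h : cyclicVar p ≤ V)
    {e : SgEq} (he : e ∈ V.ids) (x : ℕ) :
    (letters e.1).count x ≡ (letters e.2).count x [MOD p] := by
  have := congrArg Multiplicative.toAdd
    (h he fun n => Multiplicative.ofAdd (if n = x then (1 : ZMod p) else 0))
  rw [lift_commMonoid, lift_commMonoid] at this
  rw [← ZMod.natCast_eq_natCast_iff, ← sum_map_indicator, ← sum_map_indicator]
  exact this

theorem COMvar_le_of_cyclicVar_le {V : SemigroupVariety}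
    (h : ∀ N : ℕ, ∃ p > N, cyclicVar p ≤ V) : COMvar ≤ V := by
  refine COMvar_le_iff.2 fun S _ hS e he => satIdent_of_letters_eq hS (Multiset.ext.2 fun x => ?_)
  obtain ⟨p, hp, hpV⟩ := h ((letters e.1).count x + (letters e.2).count x)
  exact (count_modEq_of_cyclicVar_le hpV he x).eq_of_lt_of_lt (by omega) (by omega)

theorem eq_of_cyclicVar_eq {p q : ℕ} (hp : p.Prime) (hq : q.Prime)
    (h : cyclicVar p = cyclicVar q) : p = q :=
  (Nat.prime_dvd_prime_iff_eq hp hq).1 (dvd_of_cyclicVar_le hq.pos h.le)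

theorem COMvar_le_of_aboveAllAtomsButTwo {V : SemigroupVariety} (hV : AboveAllAtomsButTwo V) :
    COMvar ≤ V := by
  obtain ⟨a, b, hab⟩ := hV
  refine COMvar_le_of_cyclicVar_le fun N => ?_
  by_contra! hN
  have hex : ∀ p > N, p.Prime → cyclicVar p = a ∨ cyclicVar p = b := by
    intro p hpN hp
    have : Fact p.Prime := ⟨hp⟩
    exact (hab _ (isAtom_cyclicVar p)).imp_right fun h => h.resolve_right (hN p hpN)
  obtain ⟨p, hpN, hp⟩ := Nat.exists_infinite_primes (N + 1)
  obtain ⟨q, hqp, hq⟩ := Nat.exists_infinite_primes (p + 1)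
  obtain ⟨r, hrq, hr⟩ := Nat.exists_infinite_primes (q + 1)
  have hpq : cyclicVar p ≠ cyclicVar q := fun h => by
    have := eq_of_cyclicVar_eq hp hq h; omega
  have hpr : cyclicVar p ≠ cyclicVar r := fun h => by
    have := eq_of_cyclicVar_eq hp hr h; omega
  have hqr : cyclicVar q ≠ cyclicVar r := fun h => by
    have := eq_of_cyclicVar_eq hq hr h; omega
  have h1 := hex p (by omega) hp
  have h2 := hex q (by omega) hq
  have h3 := hex r (by omega) hr
  grind

theorem COMvar_le_iff_aboveAllAtomsButTwo {V : SemigroupVariety} :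
    COMvar ≤ V ↔ AboveAllAtomsButTwo V :=
  ⟨aboveAllAtomsButTwo_of_COMvar_le, COMvar_le_of_aboveAllAtomsButTwo⟩

theorem le_COMvar_iff_mem_lowerBounds {V : SemigroupVariety} :
    V ≤ COMvar ↔ V ∈ lowerBounds {W : SemigroupVariety | AboveAllAtomsButTwo W} :=
  ⟨fun h _ hW => h.trans (COMvar_le_of_aboveAllAtomsButTwo hW),
    fun h => h (aboveAllAtomsButTwo_of_COMvar_le le_rfl)⟩

/-- The set of all periodic varieties, the set of all
overcommutative varieties and the set of all commutative varieties of
semigroups are definable. -/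
theorem periodic_overcommutative_commutative_definable :
    IsDefinableVar {V : SemigroupVariety | IsPeriodicVariety V} ∧
    IsDefinableVar {V : SemigroupVariety | COMvar ≤ V} ∧
    IsDefinableVar {V : SemigroupVariety | (wx * wy, wy * wx) ∈ V.ids} := by
  have hoc : IsDefinableVar {V : SemigroupVariety | COMvar ≤ V} := by
    simp only [COMvar_le_iff_aboveAllAtomsButTwo]
    exact isDefinableIn_aboveAllAtomsButTwo
  refine ⟨?_, hoc, ?_⟩
  · simp only [isPeriodicVariety_iff]
    exact hoc.compl
  · simp only [← le_COMvar_iff, le_COMvar_iff_mem_lowerBounds]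
    exact isDefinableIn_lowerBounds_aboveAllAtomsButTwo
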